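/- Let ε ≠ 0 and let x : ℝ → ℝ and y : ℝ → (Fin n → ℝ) be differentiable with y satisfying ẏ_j(t) = (1/ε) ∑_k c j k · x(t) y_k(t) + (1/ε²) ∑_{i,k} B j i k · y_i(t) y_k(t). Then the energy E(t) := ∑_j y_j(t)² of the fast variables evolves according to Ė(t) = −(2/ε) ∑_{j,k} a j k · x(t) y_j(t) y_k(t) for all t. -/

import Mathlib

/-- A quadratic form whose symmetrized coefficients vanish is zero. -/
theorem sum_quadratic_eq_zero_of_add_swap_eq_zero {ι : Type*} [Fintype ι] (m : ι → ι → ℝ)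
    (hm : ∀ j k, m j k + m k j = 0) (v : ι → ℝ) :
    ∑ j, ∑ k, m j k * v j * v k = 0 := by
  have hswap : ∑ j, ∑ k, m k j * v k * v j = ∑ j, ∑ k, m j k * v j * v k := Finset.sum_comm
  have hsum : ∑ j, ∑ k, (m j k * v j * v k + m k j * v k * v j) = 0 :=
    Finset.sum_eq_zero fun j _ => Finset.sum_eq_zero fun k _ => by
      linear_combination (v j * v k) * hm j k
  simp only [Finset.sum_add_distrib] at hsum
  linarith

/-- A cubic form whose coefficients have vanishing cyclic sums is zero. -/
theorem sum_cubic_eq_zero_of_cyclic_sum_eq_zero {ι : Type*} [Fintype ι] (B : ι → ι → ι → ℝ)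
    (hB : ∀ i j k, B j i k + B i k j + B k j i = 0) (v : ι → ℝ) :
    ∑ j, ∑ i, ∑ k, B j i k * v j * v i * v k = 0 := by
  have hrot (f : ι → ι → ι → ℝ) : ∑ j, ∑ i, ∑ k, f i k j = ∑ j, ∑ i, ∑ k, f j i k := by
    rw [Finset.sum_comm]
    exact Finset.sum_congr rfl fun i _ => Finset.sum_comm
  have h₁ := hrot fun j i k => B j i k * v j * v i * v k
  have h₂ := hrot fun j i k => B i k j * v i * v k * v j
  have hsum : ∑ j, ∑ i, ∑ k, (B j i k * v j * v i * v k + B i k j * v i * v k * v j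
      + B k j i * v k * v j * v i) = 0 :=
    Finset.sum_eq_zero fun j _ => Finset.sum_eq_zero fun i _ => Finset.sum_eq_zero fun k _ => by
      linear_combination (v j * v i * v k) * hB i j k
  simp only [Finset.sum_add_distrib] at hsum
  linarith

/-- For the fast variables of the triad system, the energy
`E(t) = ∑_j y_j(t)²` evolves according to
`Ė(t) = −(2/ε) ∑_{j,k} a j k · x(t) y_j(t) y_k(t)`. -/
theorem triad_fast_energy_evolution
    (n : ℕ) (hn : 1 ≤ n)
    (a c : Fin n → Fin n → ℝ)
    (hac : ∀ j k, a j k + a k j + c j k + c k j = 0)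
    (B : Fin n → Fin n → Fin n → ℝ)
    (hB : ∀ i j k, B j i k + B i k j + B k j i = 0)
    (ε : ℝ) (hε : ε ≠ 0)
    (x : ℝ → ℝ) (hx : Differentiable ℝ x)
    (y : ℝ → Fin n → ℝ)
    (hy : ∀ t j, HasDerivAt (fun s => y s j)
      ((1 / ε) * ∑ k, c j k * x t * y t k
        + (1 / ε ^ 2) * ∑ i, ∑ k, B j i k * y t i * y t k) t) :
    ∀ t : ℝ, HasDerivAt (fun s => ∑ j, (y s j) ^ 2)
      (-(2 / ε) * ∑ j, ∑ k, a j k * x t * y t j * y t k) t := by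
  intro t
  have hquad : ∑ j, ∑ k, c j k * y t j * y t k = -∑ j, ∑ k, a j k * y t j * y t k := by
    have h := sum_quadratic_eq_zero_of_add_swap_eq_zero (fun j k => a j k + c j k)
      (fun j k => by linear_combination hac j k) (y t)
    simp only [add_mul, Finset.sum_add_distrib] at h
    linarith
  have hcubic := sum_cubic_eq_zero_of_cyclic_sum_eq_zero B hB (y t)
  have hderiv := HasDerivAt.fun_sum (u := Finset.univ) fun j _ => (hy t j).pow 2
  refine hderiv.congr_deriv ?_
  have hterm (j : Fin n) : ((2 : ℕ) : ℝ) * y t j ^ (2 - 1) *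
      ((1 / ε) * ∑ k, c j k * x t * y t k + (1 / ε ^ 2) * ∑ i, ∑ k, B j i k * y t i * y t k)
      = 2 / ε * x t * ∑ k, c j k * y t j * y t k
        + 2 / ε ^ 2 * ∑ i, ∑ k, B j i k * y t j * y t i * y t k := by
    have hc : ∑ k, c j k * y t j * y t k * x t = y t j * ∑ k, c j k * x t * y t k := by
      rw [Finset.mul_sum]
      exact Finset.sum_congr rfl fun k _ => by ring
    have hb : ∑ i, ∑ k, B j i k * y t j * y t i * y t k
        = y t j * ∑ i, ∑ k, B j i k * y t i * y t k := by
      simp only [Finset.mul_sum]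
      exact Finset.sum_congr rfl fun i _ => Finset.sum_congr rfl fun k _ => by ring
    rw [← Finset.sum_mul] at hc
    rw [hb]
    push_cast
    linear_combination (-(2 / ε)) * hc
  have ha : ∑ j, ∑ k, a j k * x t * y t j * y t k
      = x t * ∑ j, ∑ k, a j k * y t j * y t k := by
    simp only [Finset.mul_sum]
    exact Finset.sum_congr rfl fun j _ => Finset.sum_congr rfl fun k _ => by ring
  rw [Finset.sum_congr rfl fun j _ => hterm j, Finset.sum_add_distrib, ← Finset.mul_sum,
    ← Finset.mul_sum, hquad, hcubic, ha]
  ring
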